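/- If M' is a fragment of a definite multi-context system M (i.e., M' ⊆ M), then the grounded equilibrium of M' is pointwise contained in the grounded equilibrium of M: S'_i ⊆ S_i for every i. -/

import Mathlib

/-- A bridge rule of a definite MCS: a head literal and a finite positive body. -/
structure Rule (n : ℕ) (α : Type*) where
  head : α
  body : Finset (Fin n × α)
deriving DecidableEq

/-- A definite multi-context system: for each context, a monotone semantic
operator and a finite set of bridge rules. -/
structure MCS (n : ℕ) (α : Type*) [DecidableEq α] where
  ACC : Fin n → Finset α → Finset α
  mono : ∀ i, Monotone (ACC i)
  br : Fin n → Finset (Rule n α)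

variable {n : ℕ} {α : Type*} [DecidableEq α]

/-- A bridge rule is satisfied in a belief state `S` iff every body literal holds. -/
def Satisfied (r : Rule n α) (S : Fin n → Finset α) : Prop :=
  ∀ cp ∈ r.body, cp.2 ∈ S cp.1

instance (r : Rule n α) (S : Fin n → Finset α) : Decidable (Satisfied r S) := by
  unfold Satisfied; infer_instance

/-- The knowledge base induced at context `i` by belief state `S`:
the heads of the bridge rules of context `i` satisfied in `S`. -/
def kbOf (M : MCS n α) (S : Fin n → Finset α) (i : Fin n) : Finset α :=
  ((M.br i).filter (fun r => Satisfied r S)).image Rule.head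

/-- A belief state is an equilibrium iff each belief set is the result of
applying the semantic operator to the induced knowledge base. -/
def IsEquilibrium (M : MCS n α) (S : Fin n → Finset α) : Prop :=
  ∀ i, S i = M.ACC i (kbOf M S i)

/-- The grounded equilibrium: the pointwise-⊆-least equilibrium. -/
def IsGrounded (M : MCS n α) (S : Fin n → Finset α) : Prop :=
  IsEquilibrium M S ∧ ∀ E, IsEquilibrium M E → ∀ i, S i ⊆ E i

/-- `M'` is a fragment of `M`: same contexts and operators, fewer bridge rules. -/
def Fragment (M' M : MCS n α) : Prop :=
  M'.ACC = M.ACC ∧ ∀ i, M'.br i ⊆ M.br i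

theorem kbOf_subset_kbOf {M' M : MCS n α} (hbr : ∀ i, M'.br i ⊆ M.br i)
    {S T : Fin n → Finset α} (hST : S ≤ T) (i : Fin n) : kbOf M' S i ⊆ kbOf M T i := by
  intro a ha
  simp only [kbOf, Finset.mem_image, Finset.mem_filter] at ha ⊢
  obtain ⟨r, ⟨hr, hsat⟩, rfl⟩ := ha
  exact ⟨r, ⟨hbr i hr, fun cp hcp => hST cp.1 (hsat cp hcp)⟩, rfl⟩

/-- Below every belief state closed under the operator of `M` there is an equilibrium of `M`. -/
theorem exists_isEquilibrium_le (M : MCS n α) {S : Fin n → Finset α}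
    (hS : ∀ i, M.ACC i (kbOf M S i) ⊆ S i) : ∃ E, IsEquilibrium M E ∧ E ≤ S := by
  obtain ⟨E, hES, hE⟩ := exists_minimal_le_of_wellFoundedLT
    (fun E : Fin n → Finset α => ∀ i, M.ACC i (kbOf M E i) ⊆ E i) S hS
  refine ⟨E, fun i => (hE.le_of_le (y := fun i => M.ACC i (kbOf M E i)) ?_ hE.prop i).antisymm
    (hE.prop i), hES⟩
  exact fun j => M.mono j (kbOf_subset_kbOf (fun _ => Finset.Subset.rfl) hE.prop j)

/-- the grounded equilibrium of a fragment `M' ⊆ M` is pointwise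
contained in the grounded equilibrium of `M`. -/
theorem grounded_equilibrium_monotone_in_fragments (M M' : MCS n α)
    (hfrag : Fragment M' M) (S S' : Fin n → Finset α)
    (hS : IsGrounded M S) (hS' : IsGrounded M' S') :
    ∀ i, S' i ⊆ S i := by
  obtain ⟨E, hE, hES⟩ := exists_isEquilibrium_le M' (S := S) fun i => by
    rw [hS.1 i, hfrag.1]
    exact M.mono i (kbOf_subset_kbOf hfrag.2 le_rfl i)
  exact fun i => (hS'.2 E hE i).trans (hES i)
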